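/- arXiv:1109.5052 — 3 statements merged into one kernel-verified Lean document; each statement's English description precedes it below -/
import Mathlib

section
/- Let F be a field and let (X_i, g_{i,j}) and (Y_i, h_{i,j}) be two filtrations of finite-dimensional F-vector spaces indexed by 0 ≤ i ≤ m, connected contravariantly by a non-degenerate compatible family of bilinear pairings ⟨·,·⟩_j : X_j × Y_{m-j} → F. Then the anti-parallel maps have equal rank: for all 0 ≤ i ≤ j ≤ m, dim_F(range g_{i,j}) = dim_F(range h_{m-j,m-i}). -/
open Module LinearMap

/-- Rank inequality for a map whose target is injectively paired. -/
theorem antiparallel_rank_le {F A B C D : Type*} [Field F]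
    [AddCommGroup A] [Module F A]
    [AddCommGroup B] [Module F B] [FiniteDimensional F B]
    [AddCommGroup C] [Module F C] [FiniteDimensional F C]
    [AddCommGroup D] [Module F D] [FiniteDimensional F D]
    (g : A →ₗ[F] B) (h : C →ₗ[F] D) (p : B →ₗ[F] C →ₗ[F] F) (q : A →ₗ[F] D →ₗ[F] F)
    (hp : ∀ b : B, b ≠ 0 → ∃ c, p b c ≠ 0)
    (hc : ∀ a c, p (g a) c = q a (h c)) :
    finrank F (LinearMap.range g) ≤ finrank F (LinearMap.range h) := by
  have hinj : Function.Injective p := by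
    rw [injective_iff_map_eq_zero]
    intro b hb
    by_contra hne
    obtain ⟨c, hcc⟩ := hp b hne
    exact hcc (by rw [hb]; rfl)
  have h1 : finrank F ((LinearMap.range g).map p) = finrank F (LinearMap.range g) :=
    (Submodule.equivMapOfInjective p hinj (LinearMap.range g)).finrank_eq.symm
  rw [← LinearMap.finrank_range_dualMap_eq_finrank_range h, ← h1]
  apply Submodule.finrank_mono (M := Dual F C)
  rintro _ ⟨_, ⟨a, rfl⟩, rfl⟩
  exact ⟨q a, LinearMap.ext fun c => (hc a c).symm⟩

/-- Anti-parallel maps of contravariantly paired filtrations have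
equal rank: `dim (range g_{i,j}) = dim (range h_{m-j,m-i})`. -/
theorem antiparallel_maps_equal_rank
    (F : Type*) [Field F] (m : ℕ)
    (X Y : ℕ → Type*)
    [∀ i, AddCommGroup (X i)] [∀ i, Module F (X i)] [∀ i, FiniteDimensional F (X i)]
    [∀ i, AddCommGroup (Y i)] [∀ i, Module F (Y i)] [∀ i, FiniteDimensional F (Y i)]
    (g : ∀ i j : ℕ, i ≤ j → (X i →ₗ[F] X j))
    (h : ∀ i j : ℕ, i ≤ j → (Y i →ₗ[F] Y j))
    (gid : ∀ i, g i i le_rfl = LinearMap.id)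
    (gcomp : ∀ i j k (hij : i ≤ j) (hjk : j ≤ k),
      (g j k hjk).comp (g i j hij) = g i k (hij.trans hjk))
    (hid : ∀ i, h i i le_rfl = LinearMap.id)
    (hcomp : ∀ i j k (hij : i ≤ j) (hjk : j ≤ k),
      (h j k hjk).comp (h i j hij) = h i k (hij.trans hjk))
    (pair : ∀ j : ℕ, X j →ₗ[F] Y (m - j) →ₗ[F] F)
    (nondegX : ∀ j : ℕ, j ≤ m → ∀ ξ : X j, ξ ≠ 0 → ∃ η : Y (m - j), pair j ξ η ≠ 0)
    (nondegY : ∀ j : ℕ, j ≤ m → ∀ η : Y (m - j), η ≠ 0 → ∃ ξ : X j, pair j ξ η ≠ 0)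
    (compat : ∀ (i j : ℕ) (hij : i ≤ j), j ≤ m → ∀ (ξ' : X i) (η : Y (m - j)),
      pair j (g i j hij ξ') η
        = pair i ξ' (h (m - j) (m - i) (Nat.sub_le_sub_left hij m) η)) :
    ∀ (i j : ℕ) (hij : i ≤ j), j ≤ m →
      finrank F (LinearMap.range (g i j hij))
        = finrank F (LinearMap.range (h (m - j) (m - i) (Nat.sub_le_sub_left hij m))) := by
  intro i j hij hj
  apply le_antisymm
  · exact antiparallel_rank_le _ _ (pair j) (pair i) (nondegX j hj) (compat i j hij hj)
  · exact antiparallel_rank_le _ _ (pair i).flip (pair j).flip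
      (nondegY i (hij.trans hj)) (fun c a => (compat i j hij hj a c).symm)
end

section
/- Let F be a field and let (X_i, g_{i,j}) and (Y_i, h_{i,j}) be two filtrations of finite-dimensional F-vector spaces indexed by 0 ≤ i ≤ m, connected contravariantly by a non-degenerate compatible family of bilinear pairings ⟨·,·⟩_j : X_j × Y_{m-j} → F. Then for all 0 ≤ i ≤ j ≤ k ≤ m, dim_F(X_j) − dim_F(range(g_{i,j}) + ker(g_{j,k})) = dim_F(range(h_{m-k,m-j}) ∩ ker(h_{m-j,m-i})), i.e. the dimension of the quotient of X_j by the subspace range(g_{i,j}) + ker(g_{j,k}) equals the dimension of range(h_{m-k,m-j}) ∩ ker(h_{m-j,m-i}). -/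
open Module LinearMap

/-- The codimension of `range g_{i,j} + ker g_{j,k}` in `X_j` equals
`dim (range h_{m-k,m-j} ∩ ker h_{m-j,m-i})`. -/
theorem codim_sup_eq_dim_inf
    (F : Type*) [Field F] (m : ℕ)
    (X Y : ℕ → Type*)
    [∀ i, AddCommGroup (X i)] [∀ i, Module F (X i)] [∀ i, FiniteDimensional F (X i)]
    [∀ i, AddCommGroup (Y i)] [∀ i, Module F (Y i)] [∀ i, FiniteDimensional F (Y i)]
    (g : ∀ i j : ℕ, i ≤ j → (X i →ₗ[F] X j))
    (h : ∀ i j : ℕ, i ≤ j → (Y i →ₗ[F] Y j))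
    (gid : ∀ i, g i i le_rfl = LinearMap.id)
    (gcomp : ∀ i j k (hij : i ≤ j) (hjk : j ≤ k),
      (g j k hjk).comp (g i j hij) = g i k (hij.trans hjk))
    (hid : ∀ i, h i i le_rfl = LinearMap.id)
    (hcomp : ∀ i j k (hij : i ≤ j) (hjk : j ≤ k),
      (h j k hjk).comp (h i j hij) = h i k (hij.trans hjk))
    (pair : ∀ j : ℕ, X j →ₗ[F] Y (m - j) →ₗ[F] F)
    (nondegX : ∀ j : ℕ, j ≤ m → ∀ ξ : X j, ξ ≠ 0 → ∃ η : Y (m - j), pair j ξ η ≠ 0)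
    (nondegY : ∀ j : ℕ, j ≤ m → ∀ η : Y (m - j), η ≠ 0 → ∃ ξ : X j, pair j ξ η ≠ 0)
    (compat : ∀ (i j : ℕ) (hij : i ≤ j), j ≤ m → ∀ (ξ' : X i) (η : Y (m - j)),
      pair j (g i j hij ξ') η
        = pair i ξ' (h (m - j) (m - i) (Nat.sub_le_sub_left hij m) η)) :
    ∀ (i j k : ℕ) (hij : i ≤ j) (hjk : j ≤ k), k ≤ m →
      finrank F (X j)
          - finrank F ↥(LinearMap.range (g i j hij) ⊔ LinearMap.ker (g j k hjk))
        = finrank F ↥(LinearMap.range (h (m - k) (m - j) (Nat.sub_le_sub_left hjk m)) ⊓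
                      LinearMap.ker (h (m - j) (m - i) (Nat.sub_le_sub_left hij m))) := by
  intro i j k hij hjk hkm
  have hperf : ∀ l, l ≤ m → Function.Bijective (pair l).flip := by
    intro l hl
    have h1 : Function.Injective (pair l) := by
      rw [injective_iff_map_eq_zero]
      intro ξ hξ
      by_contra hne
      obtain ⟨η, hη⟩ := nondegX l hl ξ hne
      exact hη (by rw [hξ]; rfl)
    have h2 : Function.Injective (pair l).flip := by
      rw [injective_iff_map_eq_zero]
      intro η hη
      by_contra hne
      obtain ⟨ξ, hξ⟩ := nondegY l hl η hne
      exact hξ (by rw [← LinearMap.flip_apply, hη]; rfl)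
    exact (LinearMap.IsPerfPair.of_injective h1 h2).bijective_right
  have hjm : j ≤ m := hjk.trans hkm
  have hcomm : ∀ (a b : ℕ) (hab : a ≤ b), b ≤ m → ∀ η : Y (m - b),
      (pair a).flip (h (m - b) (m - a) (Nat.sub_le_sub_left hab m) η)
        = (g a b hab).dualMap ((pair b).flip η) := by
    intro a b hab hb η
    ext ξ
    simp [compat a b hab hb]
  have hmap : (LinearMap.range (h (m - k) (m - j) (Nat.sub_le_sub_left hjk m)) ⊓
      LinearMap.ker (h (m - j) (m - i) (Nat.sub_le_sub_left hij m))).map (pair j).flip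
      = (LinearMap.range (g i j hij) ⊔ LinearMap.ker (g j k hjk)).dualAnnihilator := by
    rw [Submodule.dualAnnihilator_sup_eq, ← LinearMap.ker_dualMap_eq_dualAnnihilator_range,
      ← LinearMap.range_dualMap_eq_dualAnnihilator_ker]
    ext φ
    constructor
    · rintro ⟨η, ⟨⟨ζ, rfl⟩, hη⟩, rfl⟩
      refine ⟨?_, ?_⟩
      · have hη' := LinearMap.mem_ker.1 hη
        change _ = _
        rw [← hcomm i j hij hjm, hη', map_zero]
      · exact ⟨(pair k).flip ζ, (hcomm j k hjk hkm ζ).symm⟩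
    · rintro ⟨h1, ⟨ψ, rfl⟩⟩
      obtain ⟨ζ, rfl⟩ := (hperf k hkm).2 ψ
      refine ⟨h (m - k) (m - j) (Nat.sub_le_sub_left hjk m) ζ, ⟨⟨ζ, rfl⟩, ?_⟩, hcomm j k hjk hkm ζ⟩
      apply LinearMap.mem_ker.2
      apply (hperf i (hij.trans hjm)).1
      rw [hcomm i j hij hjm, hcomm j k hjk hkm, map_zero]
      exact LinearMap.mem_ker.1 h1
  have hfin := Subspace.finrank_add_finrank_dualAnnihilator_eq
    (LinearMap.range (g i j hij) ⊔ LinearMap.ker (g j k hjk))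
  rw [← hmap, ← (Submodule.equivMapOfInjective _ (hperf j hjm).1 _).finrank_eq] at hfin
  omega
end

section
/- Let F be a field and let (X_i, g_{i,j}) and (Y_i, h_{i,j}) be two filtrations of finite-dimensional F-vector spaces indexed by 0 ≤ i ≤ m, connected contravariantly by a non-degenerate compatible family of bilinear pairings ⟨·,·⟩_j : X_j × Y_{m-j} → F. Then there exists a family of F-linear isomorphisms φ_j : X_j → Y_{m-j} (0 ≤ j ≤ m) that is compatible with the horizontal maps, in the sense that for all 0 ≤ i ≤ j ≤ m and every ξ in the range of g_{i,j}, one has g_{i,j}(φ_i⁻¹(h_{m-j,m-i}(φ_j(ξ)))) = ξ. -/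
open Module LinearMap

/-- A basis adapted to a finite chain of subspaces. -/
theorem aux_adapted {F V : Type*} [Field F] [AddCommGroup V] [Module F V]
    (W : ℕ → Submodule F V) (hW : Monotone W) (n : ℕ) :
    ∃ s : Set V, LinearIndepOn F id s ∧ s ⊆ W n ∧
      ∀ i ≤ n, W i ≤ Submodule.span F (s ∩ W i) := by
  induction n with
  | zero =>
    obtain ⟨b, hb, -, hsp, hli⟩ := exists_linearIndepOn_id_extension
      (K := F) (s := (∅ : Set V)) (t := W 0) (linearIndepOn_empty F id) (Set.empty_subset _)
    refine ⟨b, hli, hb, fun i hi => ?_⟩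
    obtain rfl : i = 0 := by omega
    rw [Set.inter_eq_left.2 hb]
    exact hsp
  | succ n ih =>
    obtain ⟨s, hs, hsW, hsp⟩ := ih
    obtain ⟨b, hb, hsb, hbsp, hli⟩ := exists_linearIndepOn_id_extension
      (K := F) (t := W (n + 1)) hs (hsW.trans (hW n.le_succ))
    refine ⟨b, hli, hb, fun i hi => ?_⟩
    rcases Nat.le_succ_iff.1 hi with h | rfl
    · exact (hsp i h).trans (Submodule.span_mono (Set.inter_subset_inter_left _ hsb))
    · rw [Set.inter_eq_left.2 hb]
      exact hbsp

/-- Pulling back an adapted basis along a linear map. -/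
theorem aux_step {F V V' : Type*} [Field F] [AddCommGroup V] [Module F V]
    [AddCommGroup V'] [Module F V'] (f : V →ₗ[F] V')
    (W : ℕ → Submodule F V) (hW : Monotone W) (n : ℕ)
    (s : Set V') (hs : LinearIndepOn F id s)
    (hsp : ∀ i ≤ n, (W i).map f ≤ Submodule.span F (s ∩ (W i).map f)) :
    ∃ t : Set V, LinearIndepOn F id t ∧
      (∀ i ≤ n, W i ≤ Submodule.span F (t ∩ W i)) ∧
      (∀ b ∈ t, f b = 0 ∨ f b ∈ s) ∧
      (∀ b ∈ t, ∀ b' ∈ t, f b ≠ 0 → f b = f b' → b = b') := by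
  classical
  obtain ⟨d, hd, hdW, hdsp⟩ := aux_adapted (fun i => W i ⊓ LinearMap.ker f)
    (fun i j hij => inf_le_inf_right _ (hW hij)) n
  have hlift : ∀ c : V', ∃ v : V, c ∈ s ∩ (W n).map f →
      f v = c ∧ ∀ i ≤ n, c ∈ (W i).map f → v ∈ W i := by
    intro c
    by_cases hc : c ∈ s ∩ (W n).map f
    · have hex : ∃ i, c ∈ (W i).map f := ⟨n, hc.2⟩
      obtain ⟨v, hv, hfv⟩ := Nat.find_spec hex
      exact ⟨v, fun _ => ⟨hfv, fun i _ hi => hW (Nat.find_min' hex hi) hv⟩⟩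
    · exact ⟨0, fun h => absurd h hc⟩
  choose l hl using hlift
  set T : Set V' := s ∩ (W n).map f with hT
  have hTli : LinearIndepOn F (f ∘ l) T := by
    refine (linearIndepOn_congr (v := id) ?_).1 (hs.mono Set.inter_subset_left)
    intro c hc
    exact ((hl c hc).1).symm
  have hlT : LinearIndepOn F f (l '' T) := hTli.image_of_comp l f
  have hdk : ∀ x ∈ d, f x = 0 := fun x hx => (hdW hx).2
  refine ⟨l '' T ∪ d, ?_, ?_, ?_, ?_⟩
  · refine LinearIndepOn.id_union (LinearIndepOn.of_comp f hlT) hd ?_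
    have h1 := Submodule.range_ker_disjoint (f := f) (v := fun x : l '' T => (x : V)) hlT
    rw [Subtype.range_coe] at h1
    exact h1.mono_right (Submodule.span_le.2 (fun x hx => (hdW hx).2))
  · intro i hi x hx
    have hfx : f x ∈ (Submodule.span F (l '' T ∩ W i)).map f := by
      refine Submodule.span_le.2 ?_ (hsp i hi (Submodule.mem_map_of_mem hx))
      rintro c ⟨hcs, hcW⟩
      have hcT : c ∈ T := ⟨hcs, Submodule.map_mono (hW hi) hcW⟩
      exact ⟨l c, Submodule.subset_span ⟨⟨c, hcT, rfl⟩, (hl c hcT).2 i hi hcW⟩, (hl c hcT).1⟩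
    obtain ⟨y, hy, hyx⟩ := hfx
    have hyW : y ∈ W i := Submodule.span_le.2 Set.inter_subset_right hy
    have hk : x - y ∈ Submodule.span F (d ∩ (W i ⊓ LinearMap.ker f : Submodule F V)) := by
      refine hdsp i hi ⟨(W i).sub_mem hx hyW, ?_⟩
      simp [hyx]
    rw [← sub_add_cancel x y]
    refine Submodule.add_mem _ (Submodule.span_mono ?_ hk) (Submodule.span_mono ?_ hy)
    · exact fun z hz => ⟨Or.inr hz.1, hz.2.1⟩
    · exact fun z hz => ⟨Or.inl hz.1, hz.2⟩
  · rintro b (⟨c, hc, rfl⟩ | hb)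
    · right; rw [(hl c hc).1]; exact hc.1
    · left; exact hdk b hb
  · rintro b (⟨c, hc, rfl⟩ | hb) b' (⟨c', hc', rfl⟩ | hb') h0 he
    · rw [(hl c hc).1, (hl c' hc').1] at he; rw [he]
    · exact absurd (he.trans (hdk b' hb')) h0
    · exact absurd (hdk b hb) h0
    · exact absurd (hdk b hb) h0

/-- Compatible bases for a persistence module. -/
theorem aux_bases {F : Type*} [Field F] (X : ℕ → Type*)
    [∀ i, AddCommGroup (X i)] [∀ i, Module F (X i)]
    (g : ∀ i j : ℕ, i ≤ j → (X i →ₗ[F] X j))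
    (gid : ∀ i, g i i le_rfl = LinearMap.id)
    (gcomp : ∀ i j k (hij : i ≤ j) (hjk : j ≤ k),
      (g j k hjk).comp (g i j hij) = g i k (hij.trans hjk)) (n : ℕ)
    (s : Set (X n)) (hs : LinearIndepOn F id s)
    (hsp : ∀ i (hi : i ≤ n), LinearMap.range (g i n hi) ≤
      Submodule.span F (s ∩ LinearMap.range (g i n hi))) :
    ∃ B : ∀ j, Set (X j), B n = s ∧
      (∀ j ≤ n, LinearIndepOn F id (B j) ∧ ⊤ ≤ Submodule.span F (B j)) ∧
      (∀ j < n, (∀ b ∈ B j, g j (j+1) j.le_succ b = 0 ∨ g j (j+1) j.le_succ b ∈ B (j+1)) ∧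
        (∀ b ∈ B j, ∀ b' ∈ B j, g j (j+1) j.le_succ b ≠ 0 →
          g j (j+1) j.le_succ b = g j (j+1) j.le_succ b' → b = b')) := by
  have htop : ∀ n (s : Set (X n)), (∀ i (hi : i ≤ n), LinearMap.range (g i n hi) ≤
      Submodule.span F (s ∩ LinearMap.range (g i n hi))) → ⊤ ≤ Submodule.span F s := by
    intro n s hsp
    have := hsp n le_rfl
    rw [gid, LinearMap.range_id] at this
    simpa using this
  induction n with
  | zero =>
    refine ⟨Function.update (fun _ => ∅) 0 s, by simp, ?_, fun j hj => absurd hj (by omega)⟩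
    intro j hj
    obtain rfl : j = 0 := by omega
    simpa using ⟨hs, top_le_iff.1 (htop 0 s hsp)⟩
  | succ n ih =>
    let W : ℕ → Submodule F (X n) := fun i => ⨅ hi : i ≤ n, LinearMap.range (g i n hi)
    have hWi : ∀ i (hi : i ≤ n), W i = LinearMap.range (g i n hi) := fun i hi => by
      simp [W, hi]
    have hWm : Monotone W := by
      intro i j hij
      refine le_iInf fun hj => ?_
      rw [hWi i (hij.trans hj), ← gcomp i j n hij hj]
      exact LinearMap.range_comp_le_range _ _
    have hmap : ∀ i (hi : i ≤ n), (W i).map (g n (n+1) n.le_succ) =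
        LinearMap.range (g i (n+1) (hi.trans n.le_succ)) := fun i hi => by
      rw [hWi i hi, ← LinearMap.range_comp, gcomp]
    obtain ⟨t, ht, htsp, ht1, ht2⟩ := aux_step (g n (n+1) n.le_succ) W hWm n s hs
      (fun i hi => by rw [hmap i hi]; exact hsp i _)
    obtain ⟨B, hBn, hB1, hB2⟩ := ih t ht (fun i hi => by
      have := htsp i hi
      rwa [hWi i hi] at this)
    refine ⟨Function.update B (n+1) s, by simp, ?_, ?_⟩
    · intro j hj
      rcases Nat.le_succ_iff.1 hj with h | rfl
      · rw [Function.update_of_ne (by omega)]; exact hB1 j h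
      · rw [Function.update_self]; exact ⟨hs, htop _ s hsp⟩
    · intro j hj
      rw [Function.update_of_ne (by omega : j ≠ n + 1)]
      rcases Nat.lt_succ_iff_lt_or_eq.1 hj with h | rfl
      · rw [Function.update_of_ne (by omega : j + 1 ≠ n + 1)]; exact hB2 j h
      · rw [Function.update_self, hBn]; exact ⟨ht1, ht2⟩

/-- A non-degenerate compatible family of pairings between two
contravariantly connected filtrations yields a family of compatible isomorphisms
`φ_j : X_j ≃ Y_{m-j}`: for every `ξ` in the range of `g_{i,j}` one has
`g_{i,j} (φ_i⁻¹ (h_{m-j,m-i} (φ_j ξ))) = ξ`. -/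
theorem exists_compatible_isomorphisms
    (F : Type*) [Field F] (m : ℕ)
    (X Y : ℕ → Type*)
    [∀ i, AddCommGroup (X i)] [∀ i, Module F (X i)] [∀ i, FiniteDimensional F (X i)]
    [∀ i, AddCommGroup (Y i)] [∀ i, Module F (Y i)] [∀ i, FiniteDimensional F (Y i)]
    (g : ∀ i j : ℕ, i ≤ j → (X i →ₗ[F] X j))
    (h : ∀ i j : ℕ, i ≤ j → (Y i →ₗ[F] Y j))
    (gid : ∀ i, g i i le_rfl = LinearMap.id)
    (gcomp : ∀ i j k (hij : i ≤ j) (hjk : j ≤ k),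
      (g j k hjk).comp (g i j hij) = g i k (hij.trans hjk))
    (hid : ∀ i, h i i le_rfl = LinearMap.id)
    (hcomp : ∀ i j k (hij : i ≤ j) (hjk : j ≤ k),
      (h j k hjk).comp (h i j hij) = h i k (hij.trans hjk))
    (pair : ∀ j : ℕ, X j →ₗ[F] Y (m - j) →ₗ[F] F)
    (nondegX : ∀ j : ℕ, j ≤ m → ∀ ξ : X j, ξ ≠ 0 → ∃ η : Y (m - j), pair j ξ η ≠ 0)
    (nondegY : ∀ j : ℕ, j ≤ m → ∀ η : Y (m - j), η ≠ 0 → ∃ ξ : X j, pair j ξ η ≠ 0)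
    (compat : ∀ (i j : ℕ) (hij : i ≤ j), j ≤ m → ∀ (ξ' : X i) (η : Y (m - j)),
      pair j (g i j hij ξ') η
        = pair i ξ' (h (m - j) (m - i) (Nat.sub_le_sub_left hij m) η)) :
    ∃ φ : ∀ j : ℕ, j ≤ m → (X j ≃ₗ[F] Y (m - j)),
      ∀ (i j : ℕ) (hij : i ≤ j) (hjm : j ≤ m),
        ∀ ξ ∈ LinearMap.range (g i j hij),
          g i j hij ((φ i (hij.trans hjm)).symm
            (h (m - j) (m - i) (Nat.sub_le_sub_left hij m) (φ j hjm ξ))) = ξ := by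
  classical
  obtain ⟨s, hs, -, hsp⟩ := aux_adapted (F := F) (V := X m)
    (fun i => ⨅ hi : i ≤ m, LinearMap.range (g i m hi)) (by
      intro i j hij
      refine le_iInf fun hj => (iInf_le _ (hij.trans hj)).trans ?_
      rw [← gcomp i j m hij hj]
      exact LinearMap.range_comp_le_range _ _) m
  obtain ⟨B, -, hB1, hB2⟩ := aux_bases X g gid gcomp m s hs (fun i hi => by
    have := hsp i hi
    simpa only [hi, iInf_pos] using this)
  have hB3 : ∀ i j (hij : i ≤ j), j ≤ m → (∀ b ∈ B i, g i j hij b = 0 ∨ g i j hij b ∈ B j) ∧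
      (∀ b ∈ B i, ∀ b' ∈ B i, g i j hij b ≠ 0 → g i j hij b = g i j hij b' → b = b') := by
    intro i j hij
    induction j, hij using Nat.le_induction with
    | base =>
      intro _
      rw [gid]
      exact ⟨fun b hb => Or.inr hb, fun b _ b' _ _ h => h⟩
    | succ j hij ih =>
      intro hj
      obtain ⟨h1, h2⟩ := ih (by omega)
      obtain ⟨h3, h4⟩ := hB2 j (by omega)
      have hc : ∀ b, g i (j+1) (hij.trans j.le_succ) b = g j (j+1) j.le_succ (g i j hij b) :=
        fun b => by rw [← gcomp i j (j+1) hij j.le_succ]; rfl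
      have hmem : ∀ b ∈ B i, g i (j+1) (hij.trans j.le_succ) b ≠ 0 → g i j hij b ∈ B j := by
        intro b hb h0
        rcases h1 b hb with h | h
        · rw [hc, h, map_zero] at h0; exact absurd rfl h0
        · exact h
      constructor
      · intro b hb
        by_cases h0 : g i (j+1) (hij.trans j.le_succ) b = 0
        · exact Or.inl h0
        · right
          rcases h3 _ (hmem b hb h0) with h | h
          · exact absurd ((hc b).trans h) h0
          · rw [hc]; exact h
      · intro b hb b' hb' h0 he
        have m1 := hmem b hb h0
        have m2 := hmem b' hb' (he ▸ h0)
        refine h2 b hb b' hb' (fun h => h0 (by rw [hc, h, map_zero])) ?_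
        exact h4 _ m1 _ m2 (by rwa [← hc]) (by rwa [← hc, ← hc])
  let bas : ∀ j, j ≤ m → Basis (B j) F (X j) := fun j hj =>
    Basis.mk (v := fun x : B j => (x : X j)) (hB1 j hj).1
      (by rw [Subtype.range_coe]; exact (hB1 j hj).2)
  have hbas : ∀ j hj (x : B j), bas j hj x = x := fun j hj x => Basis.mk_apply _ _ x
  have hperf : ∀ j, j ≤ m → (pair j).flip.IsPerfPair := by
    intro j hj
    refine LinearMap.IsPerfPair.of_injective ?_ ?_
    · refine (injective_iff_map_eq_zero _).2 fun η hη => ?_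
      by_contra hne
      obtain ⟨ξ, hξ⟩ := nondegY j hj η hne
      exact hξ (LinearMap.congr_fun hη ξ)
    · refine (injective_iff_map_eq_zero _).2 fun ξ hξ => ?_
      by_contra hne
      obtain ⟨η, hη⟩ := nondegX j hj ξ hne
      exact hη (LinearMap.congr_fun hξ η)
  have hφ : ∀ j (hj : j ≤ m), ∃ φ : X j ≃ₗ[F] Y (m - j),
      ∀ ξ x, pair j x (φ ξ) = (bas j hj).toDual ξ x := by
    intro j hj
    have := hperf j hj
    have : Finite (B j) := Module.Finite.finite_basis (bas j hj)
    refine ⟨(bas j hj).toDualEquiv.trans (pair j).flip.toPerfPair.symm, fun ξ x => ?_⟩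
    have := LinearMap.congr_fun ((pair j).flip.toPerfPair.apply_symm_apply
      ((bas j hj).toDualEquiv ξ)) x
    exact this
  choose φ hφ using hφ
  refine ⟨φ, fun i j hij hjm ξ hξ => ?_⟩
  have him := hij.trans hjm
  obtain ⟨x, rfl⟩ := hξ
  obtain ⟨h1, h2⟩ := hB3 i j hij hjm
  -- reduce to basis vectors
  let A : X i →ₗ[F] X j := (g i j hij) ∘ₗ (φ i him).symm.toLinearMap ∘ₗ
    (h (m - j) (m - i) (Nat.sub_le_sub_left hij m)) ∘ₗ (φ j hjm).toLinearMap ∘ₗ (g i j hij)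
  suffices hA : A = g i j hij from LinearMap.congr_fun hA x
  refine (bas i him).ext fun b => ?_
  change g i j hij ((φ i him).symm (h (m - j) (m - i) (Nat.sub_le_sub_left hij m)
    (φ j hjm (g i j hij (bas i him b))))) = g i j hij (bas i him b)
  by_cases h0 : g i j hij (bas i him b) = 0
  · simp [h0]
  congr 1
  rw [LinearEquiv.symm_apply_eq]
  have := hperf i him
  apply (pair i).flip.toPerfPair.injective
  refine (bas i him).ext fun a => ?_
  change pair i (bas i him a) _ = pair i (bas i him a) _
  rw [← compat i j hij hjm, hφ, hφ, Basis.toDual_apply]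
  have hbj : g i j hij (b : X i) ∈ B j := by
    rcases h1 b b.2 with hh | hh
    · rw [hbas i him] at h0; exact absurd hh h0
    · exact hh
  rw [hbas i him] at h0
  have eb : bas j hjm ⟨_, hbj⟩ = g i j hij (b : X i) := hbas j hjm ⟨_, hbj⟩
  rw [hbas i him, hbas i him, ← eb]
  rcases h1 a a.2 with hh | hh
  · rw [hh, map_zero, if_neg]
    rintro rfl
    exact h0 hh
  · have e : bas j hjm ⟨_, hh⟩ = g i j hij (a : X i) := hbas j hjm ⟨_, hh⟩
    rw [← e, Basis.toDual_apply]
    congr 1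
    refine propext ⟨fun hab => ?_, fun hab => by subst hab; rfl⟩
    exact Subtype.ext (h2 b b.2 a a.2 h0 (congrArg Subtype.val hab))
end
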